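/- Let L be a domain and let E be a Polish space (a separable completely metrizable topological space). Every L-valued 𝓕-smooth σ-maxitive measure on the Borel σ-algebra ℬ of E is tight and regular. -/

import Mathlib

open Set

universe u v

section OrderDefs
variable {L : Type u} [PartialOrder L]

/-- A filtered (nonempty, downward directed) subset of a poset. -/
def DirFiltered (F : Set L) : Prop :=
  F.Nonempty ∧ ∀ r ∈ F, ∀ s ∈ F, ∃ t ∈ F, t ≤ r ∧ t ≤ s

/-- A filter of a poset: a filtered upper set. -/
def OrdFilter (F : Set L) : Prop :=
  DirFiltered F ∧ ∀ r ∈ F, ∀ s : L, r ≤ s → s ∈ F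

/-- Every filter has an infimum. -/
def FilteredComplete (L : Type u) [PartialOrder L] : Prop :=
  ∀ F : Set L, OrdFilter F → ∃ i : L, IsGLB F i

/-- `s` is way-above `r`: for every filter `F` with an infimum below `r`, `s ∈ F`. -/
def WayAbove (s r : L) : Prop :=
  ∀ F : Set L, OrdFilter F → ∀ i : L, IsGLB F i → i ≤ r → s ∈ F

/-- The poset is continuous: for every `r`, the set of elements way-above `r`
is a filter whose infimum is `r`. -/
def ContinuousPoset (L : Type u) [PartialOrder L] : Prop :=
  ∀ r : L, OrdFilter {s : L | WayAbove s r} ∧ IsGLB {s : L | WayAbove s r} r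

/-- Conditional completeness: every nonempty set bounded above has a supremum. -/
def CondComplete (L : Type u) [PartialOrder L] : Prop :=
  ∀ S : Set L, S.Nonempty → BddAbove S → ∃ m : L, IsLUB S m

end OrderDefs

/-- A domain: a filtered-complete continuous poset with a least element. -/
def DomainPoset (L : Type u) [PartialOrder L] [OrderBot L] : Prop :=
  FilteredComplete L ∧ ContinuousPoset L

section TopDefs
variable {E : Type v} [TopologicalSpace E]

/-- The saturation of a set: intersection of all open sets containing it. -/
def satur (A : Set E) : Set E := ⋂₀ {G : Set E | IsOpen G ∧ A ⊆ G}

/-- A set is saturated if it is an intersection of open sets. -/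
def IsSatur (A : Set E) : Prop :=
  ∃ 𝒢 : Set (Set E), (∀ G ∈ 𝒢, IsOpen G) ∧ A = ⋂₀ 𝒢

/-- The collection 𝒬 of compact saturated subsets. -/
def CompactSat (E : Type v) [TopologicalSpace E] : Set (Set E) :=
  {A : Set E | IsCompact A ∧ IsSatur A}

/-- The Borel σ-algebra generated by open sets and compact saturated sets. -/
def BorelM (E : Type v) [TopologicalSpace E] : MeasurableSpace E :=
  MeasurableSpace.generateFrom ({A : Set E | IsOpen A} ∪ CompactSat E)

/-- Borel subsets for the σ-algebra generated by opens and compact saturated sets. -/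
def IsBorelSet (B : Set E) : Prop := @MeasurableSet E (BorelM E) B

/-- The collection 𝒦 of compact Borel subsets. -/
def CompactBorel (E : Type v) [TopologicalSpace E] : Set (Set E) :=
  {A : Set E | IsBorelSet A ∧ IsCompact A}

/-- `[x]` : the compact Borel set `↑{x} ∩ closure {x}`. -/
def ptClass (x : E) : Set E := satur {x} ∩ closure {x}

end TopDefs

section MeasDefs
variable {L : Type u} {E : Type v} [PartialOrder L] [OrderBot L] [TopologicalSpace E]

/-- An L-valued maxitive measure on the Borel σ-algebra. -/
def Maxitive (ν : Set E → L) : Prop :=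
  ν ∅ = ⊥ ∧ ∀ 𝒞 : Set (Set E), 𝒞.Finite → (∀ B ∈ 𝒞, IsBorelSet B) →
    IsLUB (ν '' 𝒞) (ν (⋃₀ 𝒞))

/-- σ-maxitivity. -/
def SigmaMaxitive (ν : Set E → L) : Prop :=
  Maxitive ν ∧ ∀ 𝒞 : Set (Set E), 𝒞.Countable → (∀ B ∈ 𝒞, IsBorelSet B) →
    IsLUB (ν '' 𝒞) (ν (⋃₀ 𝒞))

/-- Complete maxitivity. -/
def CompletelyMaxitive (ν : Set E → L) : Prop :=
  Maxitive ν ∧ ∀ 𝒞 : Set (Set E), (∀ B ∈ 𝒞, IsBorelSet B) → IsBorelSet (⋃₀ 𝒞) →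
    IsLUB (ν '' 𝒞) (ν (⋃₀ 𝒞))

/-- The set `{ν G : G open, G ⊇ B}`. -/
def outerVals (ν : Set E → L) (B : Set E) : Set L :=
  {l : L | ∃ G : Set E, IsOpen G ∧ B ⊆ G ∧ ν G = l}

/-- `νp` is the map `ν⁺ : B ↦ inf {ν G : G open, G ⊇ B}` on Borel sets. -/
def IsNuPlus (ν νp : Set E → L) : Prop :=
  ∀ B : Set E, IsBorelSet B → IsGLB (outerVals ν B) (νp B)

/-- Outer-continuity. -/
def OuterContinuous (ν : Set E → L) : Prop :=
  ∀ B : Set E, IsBorelSet B → IsGLB (outerVals ν B) (ν B)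

/-- Inner-continuity. -/
def InnerContinuous (ν : Set E → L) : Prop :=
  ∀ B : Set E, IsBorelSet B →
    IsLUB {l : L | ∃ K : Set E, IsBorelSet K ∧ IsCompact K ∧ K ⊆ B ∧ ν (satur K) = l} (ν B)

/-- Regularity: inner- and outer-continuity. -/
def RegularMeasure (ν : Set E → L) : Prop :=
  InnerContinuous ν ∧ OuterContinuous ν

/-- Weak outer-continuity: `ν K = ν⁺ K` for every compact Borel `K`. -/
def WeaklyOuterContinuous (ν : Set E → L) : Prop :=
  ∀ K : Set E, IsBorelSet K → IsCompact K → IsGLB (outerVals ν K) (ν K)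

/-- Weak inner-continuity (relative to a given `ν⁺ = νp`). -/
def WeaklyInnerContinuous (ν νp : Set E → L) : Prop :=
  ∀ G : Set E, IsOpen G →
    IsLUB {l : L | ∃ K : Set E, IsBorelSet K ∧ IsCompact K ∧ K ⊆ G ∧ νp K = l} (ν G)

/-- 𝒜-smoothness. -/
def SmoothWrt (ν : Set E → L) (𝒜 : Set (Set E)) : Prop :=
  ∀ 𝒟 : Set (Set E), 𝒟.Nonempty → 𝒟 ⊆ 𝒜 → DirectedOn (· ⊇ ·) 𝒟 →
    IsGLB (ν '' 𝒟) (ν (⋂₀ 𝒟))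

/-- Saturation of a maxitive measure: `ν K = ν (↑K)` for compact Borel `K`. -/
def SaturatedMeasure (ν : Set E → L) : Prop :=
  ∀ K : Set E, IsBorelSet K → IsCompact K → ν K = ν (satur K)

/-- Tightness: `inf {ν (E ∖ K) : K compact Borel} = 0`. -/
def TightMeasure (ν : Set E → L) : Prop :=
  IsGLB {l : L | ∃ K : Set E, IsBorelSet K ∧ IsCompact K ∧ ν Kᶜ = l} (⊥ : L)

/-- `c` is a cardinal density of `ν`. -/
def IsCardinalDensity (ν : Set E → L) (c : E → L) : Prop :=
  ∀ B : Set E, IsBorelSet B → IsLUB (c '' B) (ν B)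

/-- Upper semicontinuity of a map into the poset. -/
def UscMap (c : E → L) : Prop := ∀ t : L, IsOpen {x : E | WayAbove t (c x)}

/-- Upper compactness of a map into the poset. -/
def UpperCompactMap (c : E → L) : Prop :=
  ∀ t : L, WayAbove t (⊥ : L) → IsCompact {x : E | ¬ WayAbove t (c x)}

/-- Continuity from above along decreasing sequences of Borel sets. -/
def ContinuousFromAbove (ν : Set E → L) : Prop :=
  ∀ B : ℕ → Set E, (∀ n, IsBorelSet (B n)) → (∀ n, B (n + 1) ⊆ B n) →
    IsGLB (Set.range fun n => ν (B n)) (ν (⋂ n, B n))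

/-- An optimal measure: a σ-maxitive measure continuous from above. -/
def OptimalMeasure (ν : Set E → L) : Prop :=
  SigmaMaxitive ν ∧ ContinuousFromAbove ν

/-- `flo` is the regular part `⌊ν⌋` (relative to `νp = ν⁺`):
`⌊ν⌋(B) = sup {ν⁺(K) : K compact Borel, K ⊆ B}`. -/
def RegPartRel (νp flo : Set E → L) : Prop :=
  ∀ B : Set E, IsBorelSet B →
    IsLUB {l : L | ∃ K : Set E, IsBorelSet K ∧ IsCompact K ∧ K ⊆ B ∧ νp K = l} (flo B)

end MeasDefs

theorem WayAbove.exists_le {L : Type u} [PartialOrder L] {r s i : L} (h : WayAbove s r)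
    {S : Set L} (hne : S.Nonempty) (hdir : ∀ a ∈ S, ∀ b ∈ S, ∃ c ∈ S, c ≤ a ∧ c ≤ b)
    (hi : IsGLB S i) (hir : i ≤ r) : ∃ a ∈ S, a ≤ s := by
  refine h {x | ∃ a ∈ S, a ≤ x} ⟨⟨?_, ?_⟩, ?_⟩ i ⟨?_, ?_⟩ hir
  · obtain ⟨a, ha⟩ := hne
    exact ⟨a, a, ha, le_rfl⟩
  · rintro x ⟨a, ha, hax⟩ y ⟨b, hb, hby⟩
    obtain ⟨c, hc, hca, hcb⟩ := hdir a ha b hb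
    exact ⟨c, ⟨c, hc, le_rfl⟩, hca.trans hax, hcb.trans hby⟩
  · rintro x ⟨a, ha, hax⟩ y hxy
    exact ⟨a, ha, hax.trans hxy⟩
  · rintro x ⟨a, ha, hax⟩
    exact (hi.1 ha).trans hax
  · exact fun l hl => hi.2 fun a ha => hl ⟨a, ha, le_rfl⟩

theorem ContinuousPoset.le_of_forall_wayAbove {L : Type u} [PartialOrder L]
    (hL : ContinuousPoset L) {l r : L} (h : ∀ t, WayAbove t r → l ≤ t) : l ≤ r :=
  (hL r).2.2 h

theorem IsOpen.isBorelSet {E : Type v} [TopologicalSpace E] {G : Set E} (hG : IsOpen G) :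
    IsBorelSet G :=
  MeasurableSpace.measurableSet_generateFrom (Or.inl hG)

theorem IsClosed.isBorelSet {E : Type v} [TopologicalSpace E] {C : Set E} (hC : IsClosed C) :
    IsBorelSet C :=
  (@MeasurableSet.compl_iff E C (BorelM E)).1 hC.isOpen_compl.isBorelSet

theorem satur_eq_self {E : Type v} [TopologicalSpace E] [T1Space E] (A : Set E) :
    satur A = A := by
  refine Subset.antisymm (fun x hx => ?_) (subset_sInter fun G hG => hG.2)
  by_contra hxA
  exact hx {x}ᶜ ⟨isOpen_compl_singleton, fun y hy hyx => hxA (hyx ▸ hy)⟩ rfl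

section
variable {L : Type u} {E : Type v} [PartialOrder L] [OrderBot L] [TopologicalSpace E]
  {ν : Set E → L}

theorem Maxitive.mono (hν : Maxitive ν) {A B : Set E} (hA : IsBorelSet A) (hB : IsBorelSet B)
    (h : A ⊆ B) : ν A ≤ ν B := by
  have := hν.2 {A, B} (by simp) (by rintro C (rfl | rfl) <;> assumption)
  rw [sUnion_pair, union_eq_self_of_subset_left h] at this
  exact this.1 ⟨A, by simp, rfl⟩

theorem SmoothWrt.exists_le_of_wayAbove (hν : Maxitive ν)
    (hF : SmoothWrt ν {A : Set E | IsClosed A}) {𝒟 : Set (Set E)} (hne : 𝒟.Nonempty)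
    (hcl : ∀ C ∈ 𝒟, IsClosed C) (hdir : DirectedOn (· ⊇ ·) 𝒟) {t u : L} (ht : WayAbove t u)
    (hu : ν (⋂₀ 𝒟) ≤ u) : ∃ C ∈ 𝒟, ν C ≤ t := by
  have hdir' : ∀ a ∈ ν '' 𝒟, ∀ b ∈ ν '' 𝒟, ∃ c ∈ ν '' 𝒟, c ≤ a ∧ c ≤ b := by
    rintro _ ⟨A, hA, rfl⟩ _ ⟨B, hB, rfl⟩
    obtain ⟨C, hC, hCA, hCB⟩ := hdir A hA B hB
    exact ⟨ν C, ⟨C, hC, rfl⟩,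
      hν.mono (hcl C hC).isBorelSet (hcl A hA).isBorelSet hCA,
      hν.mono (hcl C hC).isBorelSet (hcl B hB).isBorelSet hCB⟩
  obtain ⟨_, ⟨C, hC, rfl⟩, hCt⟩ := ht.exists_le (hne.image ν) hdir' (hF 𝒟 hne hcl hdir) hu
  exact ⟨C, hC, hCt⟩

theorem SmoothWrt.exists_nhds_le [T3Space E] (hν : Maxitive ν)
    (hF : SmoothWrt ν {A : Set E | IsClosed A}) {x : E} {t u : L} (ht : WayAbove t u)
    (hu : ν {x} ≤ u) : ∃ C ∈ nhds x, IsClosed C ∧ ν C ≤ t := by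
  have hinter : ⋂₀ {C : Set E | C ∈ nhds x ∧ IsClosed C} = {x} := by
    refine Subset.antisymm (fun y hy => ?_) ?_
    · by_contra hyx
      obtain ⟨C, hC, hCc, hCy⟩ := exists_mem_nhds_isClosed_subset
        (isOpen_compl_singleton.mem_nhds (x := x) (s := {y}ᶜ) fun h => hyx h.symm)
      exact hCy (hy C ⟨hC, hCc⟩) rfl
    · rintro y rfl C hC
      exact mem_of_mem_nhds hC.1
  obtain ⟨C, hC, hCt⟩ := hF.exists_le_of_wayAbove hν (𝒟 := {C | C ∈ nhds x ∧ IsClosed C})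
    ⟨univ, Filter.univ_mem, isClosed_univ⟩ (fun C hC => hC.2)
    (fun A hA B hB => ⟨A ∩ B, ⟨Filter.inter_mem hA.1 hB.1, hA.2.inter hB.2⟩,
      inter_subset_left, inter_subset_right⟩) ht (hinter ▸ hu)
  exact ⟨C, hC.1, hC.2, hCt⟩

theorem SigmaMaxitive.exists_isOpen_le [T3Space E] [SecondCountableTopology E]
    (hν : SigmaMaxitive ν) (hF : SmoothWrt ν {A : Set E | IsClosed A}) {B : Set E} {t u : L}
    (ht : WayAbove t u) (hu : ∀ x ∈ B, ν {x} ≤ u) : ∃ G, IsOpen G ∧ B ⊆ G ∧ ν G ≤ t := by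
  have hopen : ∀ b ∈ TopologicalSpace.countableBasis E, IsOpen b := fun b hb =>
    TopologicalSpace.isOpen_of_mem_countableBasis hb
  refine ⟨⋃₀ {b ∈ TopologicalSpace.countableBasis E | ν b ≤ t},
    isOpen_sUnion fun b hb => hopen b hb.1, fun x hx => ?_, ?_⟩
  · obtain ⟨C, hC, hCc, hCt⟩ := hF.exists_nhds_le hν.1 ht (hu x hx)
    obtain ⟨b, hb, hxb, hbC⟩ :=
      (TopologicalSpace.isBasis_countableBasis E).mem_nhds_iff.1 hC
    exact ⟨b, ⟨hb, (hν.1.mono (hopen b hb).isBorelSet hCc.isBorelSet hbC).trans hCt⟩, hxb⟩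
  · refine (hν.2 _ ((TopologicalSpace.countable_countableBasis E).mono (sep_subset _ _))
      fun b hb => (hopen b hb.1).isBorelSet).2 ?_
    rintro _ ⟨b, hb, rfl⟩
    exact hb.2

theorem SigmaMaxitive.outerContinuous [T3Space E] [SecondCountableTopology E]
    (hL : ContinuousPoset L) (hν : SigmaMaxitive ν)
    (hF : SmoothWrt ν {A : Set E | IsClosed A}) : OuterContinuous ν := by
  refine fun B hB => ⟨?_, fun l hl => hL.le_of_forall_wayAbove fun t ht => ?_⟩
  · rintro _ ⟨G, hG, hBG, rfl⟩
    exact hν.1.mono hB hG.isBorelSet hBG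
  · obtain ⟨G, hG, hBG, hGt⟩ := hν.exists_isOpen_le hF ht fun x hx =>
      hν.1.mono isClosed_singleton.isBorelSet hB (singleton_subset_iff.2 hx)
    exact (hl ⟨G, hG, hBG, rfl⟩).trans hGt

theorem SigmaMaxitive.innerContinuous [T3Space E] [SecondCountableTopology E]
    (hL : ContinuousPoset L) (hν : SigmaMaxitive ν)
    (hF : SmoothWrt ν {A : Set E | IsClosed A}) : InnerContinuous ν := by
  refine fun B hB => ⟨?_, fun l hl => hL.le_of_forall_wayAbove fun t ht => ?_⟩
  · rintro _ ⟨K, hK, -, hKB, rfl⟩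
    rw [satur_eq_self]
    exact hν.1.mono hK hB hKB
  · obtain ⟨G, hG, hBG, hGt⟩ := hν.exists_isOpen_le hF ht (B := B) fun x hx =>
      hl ⟨{x}, isClosed_singleton.isBorelSet, isCompact_singleton,
        singleton_subset_iff.2 hx, by rw [satur_eq_self]⟩
    exact (hν.1.mono hB hG.isBorelSet hBG).trans hGt

end

theorem SmoothWrt.exists_finite_cover_le {L : Type u} {E : Type v} [PartialOrder L] [OrderBot L]
    [PseudoMetricSpace E] {ν : Set E → L} (hν : Maxitive ν)
    (hF : SmoothWrt ν {A : Set E | IsClosed A}) {t : L} (ht : WayAbove t ⊥) {ε : ℝ}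
    (hε : 0 < ε) : ∃ s : Set E, s.Finite ∧ ν (⋃ x ∈ s, Metric.ball x ε)ᶜ ≤ t := by
  set 𝒟 := (fun s : Set E => (⋃ x ∈ s, Metric.ball x ε)ᶜ) '' {s | s.Finite}
  have hinter : ⋂₀ 𝒟 = ∅ := by
    refine eq_empty_of_forall_notMem fun x hx => hx _ ⟨{x}, finite_singleton x, rfl⟩ ?_
    simpa using hε
  have hcl : ∀ C ∈ 𝒟, IsClosed C := by
    rintro _ ⟨s, -, rfl⟩
    exact (isOpen_biUnion fun _ _ => Metric.isOpen_ball).isClosed_compl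
  have hdir : DirectedOn (· ⊇ ·) 𝒟 := by
    rintro _ ⟨s, hs, rfl⟩ _ ⟨s', hs', rfl⟩
    exact ⟨_, ⟨s ∪ s', Finite.union hs hs', rfl⟩,
      compl_subset_compl.2 (biUnion_subset_biUnion_left subset_union_left),
      compl_subset_compl.2 (biUnion_subset_biUnion_left subset_union_right)⟩
  obtain ⟨_, ⟨s, hs, rfl⟩, hst⟩ := hF.exists_le_of_wayAbove hν (𝒟 := 𝒟)
    ⟨_, ∅, finite_empty, rfl⟩ hcl hdir ht (by rw [hinter, hν.1])
  exact ⟨s, hs, hst⟩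

theorem SigmaMaxitive.tightMeasure {L : Type u} {E : Type v} [PartialOrder L] [OrderBot L]
    [MetricSpace E] [CompleteSpace E] {ν : Set E → L} (hL : ContinuousPoset L)
    (hν : SigmaMaxitive ν) (hF : SmoothWrt ν {A : Set E | IsClosed A}) : TightMeasure ν := by
  refine ⟨fun _ _ => bot_le, fun l hl => hL.le_of_forall_wayAbove fun t ht => ?_⟩
  choose s hs hst using fun n : ℕ =>
    hF.exists_finite_cover_le hν.1 ht (Nat.one_div_pos_of_nat (α := ℝ) (n := n))
  set U : ℕ → Set E := fun n => ⋃ x ∈ s n, Metric.ball x (1 / ((n : ℝ) + 1))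
  have hUc : ∀ n, IsBorelSet (U n)ᶜ := fun n =>
    (isOpen_biUnion fun _ _ => Metric.isOpen_ball).isClosed_compl.isBorelSet
  have htb : TotallyBounded (⋂ n, U n) := by
    refine Metric.totallyBounded_iff.2 fun ε hε => ?_
    obtain ⟨n, hn⟩ := exists_nat_one_div_lt hε
    exact ⟨s n, hs n, (iInter_subset U n).trans
      (iUnion₂_mono fun x _ => Metric.ball_subset_ball hn.le)⟩
  have hcpt : IsCompact (closure (⋂ n, U n)) := htb.closure.isCompact_of_isClosed isClosed_closure
  have hlub := hν.2 (range fun n => (U n)ᶜ) (countable_range _) (by rintro _ ⟨n, rfl⟩; exact hUc n)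
  have hle : ν (⋃₀ range fun n => (U n)ᶜ) ≤ t := by
    refine hlub.2 ?_
    rintro _ ⟨_, ⟨n, rfl⟩, rfl⟩
    exact hst n
  refine (hl ⟨_, isClosed_closure.isBorelSet, hcpt, rfl⟩).trans (le_trans ?_ hle)
  refine hν.1.mono isClosed_closure.isOpen_compl.isBorelSet ?_ ?_
  · rw [sUnion_range]
    exact @MeasurableSet.iUnion E ℕ (BorelM E) _ _ hUc
  · rw [sUnion_range, ← compl_iInter]
    exact compl_subset_compl.2 subset_closure

/-- on a Polish space, every 𝓕-smooth σ-maxitive measure is tight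
and regular. -/
theorem stmt10 {L : Type u} {E : Type v} [PartialOrder L] [OrderBot L]
    [TopologicalSpace E] [PolishSpace E] (hL : DomainPoset L)
    (ν : Set E → L) (hν : SigmaMaxitive ν) (hF : SmoothWrt ν {A : Set E | IsClosed A}) :
    TightMeasure ν ∧ RegularMeasure ν := by
  let := TopologicalSpace.upgradeIsCompletelyMetrizable E
  exact ⟨hν.tightMeasure hL.2 hF, hν.innerContinuous hL.2 hF, hν.outerContinuous hL.2 hF⟩
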